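/- Let d ≥ 3. For every h > 0, every bounded continuous u : [0,∞) → ℝ^d and every t ≥ 0, |𝓕^(h)(u)(t)| ≤ 2 ‖g‖_{L¹} + (d − 2) π^{d/2} ‖ĝ‖_{L¹} = 2 C_g^1. -/

import Mathlib

open MeasureTheory Filter Set
open scoped RealInnerProductSpace Topology ENNReal

noncomputable section

abbrev E (d : ℕ) := EuclideanSpace ℝ (Fin d)

/-- `g(η) = η |f(η)|²`. -/
def gfun {d : ℕ} (f : SchwartzMap (E d) ℂ) (η : E d) : E d := ‖f η‖ ^ 2 • η

/-- the average `⨍_a^b u(σ) dσ`. -/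
def intAvg {d : ℕ} (u : ℝ → E d) (a b : ℝ) : E d := (b - a)⁻¹ • ∫ σ in a..b, u σ

/-- `𝓕^(h)(u)(t)`; since `g` is real-valued, taking the real part of the complex
integral amounts to replacing `e^{-irθ}` by `cos (rθ)`. -/
def calF {d : ℕ} (f : SchwartzMap (E d) ℂ) (h : ℝ) (u : ℝ → E d) (t : ℝ) : E d :=
  (-2 : ℝ) • ∫ η, (∫ r in (0:ℝ)..(t / h),
    Real.cos (r * (‖η‖ ^ 2 - 2 * ⟪η, intAvg u (t - h * r) t⟫))) • gfun f η

/-- the `i`-th component of the Fourier transform `ĝ(x) = (2π)^{-d/2} ∫ e^{-ix·η} g(η) dη`. -/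
def ftGi {d : ℕ} (f : SchwartzMap (E d) ℂ) (i : Fin d) (x : E d) : ℂ :=
  ((2 * Real.pi) ^ (-(d : ℝ) / 2) : ℝ) *
    ∫ η, Complex.exp (-Complex.I * (⟪x, η⟫ : ℝ)) * ((gfun f η i : ℝ) : ℂ)

/-- `‖g‖_{L¹}`. -/
def L1g {d : ℕ} (f : SchwartzMap (E d) ℂ) : ℝ := ∫ η, ‖gfun f η‖

/-- `‖ĝ‖_{L¹}` (with the euclidean norm of the complex vector `ĝ(x)`). -/
def L1ftg {d : ℕ} (f : SchwartzMap (E d) ℂ) : ℝ :=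
  ∫ x, Real.sqrt (∑ i, ‖ftGi f i x‖ ^ 2)

/-- `C_g^1 = ‖g‖_{L¹} + (d/2 − 1) π^{d/2} ‖ĝ‖_{L¹}`. -/
def Cg1 {d : ℕ} (f : SchwartzMap (E d) ℂ) : ℝ :=
  L1g f + ((d : ℝ) / 2 - 1) * Real.pi ^ ((d : ℝ) / 2) * L1ftg f

open scoped FourierTransform SchwartzMap

section Gaussian

variable {V : Type*} [NormedAddCommGroup V] [InnerProductSpace ℝ V] [FiniteDimensional ℝ V]
  [MeasurableSpace V] [BorelSpace V]

theorem integrable_gaussian_modulated {b : ℂ} (hb : 0 < b.re) (x : V) :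
    Integrable fun v : V ↦
      Complex.exp (-b * ‖v‖ ^ 2 + 2 * Real.pi * Complex.I * (⟪x, v⟫ : ℝ)) :=
  GaussianFourier.integrable_cexp_neg_mul_sq_norm_add hb _ _

theorem norm_fourier_gaussian_modulated_le {b : ℂ} (hb : 0 < b.re) (x w : V) :
    ‖𝓕 (fun v : V ↦ Complex.exp (-b * ‖v‖ ^ 2 + 2 * Real.pi * Complex.I * (⟪x, v⟫ : ℝ))) w‖ ≤
      (Real.pi / ‖b‖) ^ ((Module.finrank ℝ V : ℝ) / 2) := by
  rw [fourier_gaussian_innerProductSpace' hb, norm_mul]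
  have h1 : ‖((Real.pi : ℂ) / b) ^ ((Module.finrank ℝ V : ℂ) / 2)‖ =
      (Real.pi / ‖b‖) ^ ((Module.finrank ℝ V : ℝ) / 2) := by
    have : ((Module.finrank ℝ V : ℂ) / 2) = (((Module.finrank ℝ V : ℝ) / 2 : ℝ) : ℂ) := by
      push_cast; rfl
    rw [this, Complex.norm_cpow_real, norm_div, Complex.norm_real, Real.norm_of_nonneg Real.pi_nonneg]
  rw [h1]
  refine mul_le_of_le_one_right (by positivity) ?_
  rw [Complex.norm_exp, Real.exp_le_one_iff]
  have : (-(Real.pi : ℂ) ^ 2 * (‖x - w‖ : ℂ) ^ 2 / b) =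
      ((-(Real.pi ^ 2 * ‖x - w‖ ^ 2) : ℝ) : ℂ) * b⁻¹ := by
    push_cast; ring
  rw [this, Complex.re_ofReal_mul, Complex.inv_re]
  have := Complex.normSq_nonneg b
  have : 0 ≤ b.re / Complex.normSq b := by positivity
  nlinarith [mul_nonneg (by positivity : 0 ≤ Real.pi ^ 2 * ‖x - w‖ ^ 2) this]

theorem norm_integral_gaussian_mul_le {b : ℂ} (hb : 0 < b.re) (x : V) (G : 𝓢(V, ℂ)) :
    ‖∫ v, Complex.exp (-b * ‖v‖ ^ 2 + 2 * Real.pi * Complex.I * (⟪x, v⟫ : ℝ)) * G v‖ ≤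
      (Real.pi / ‖b‖) ^ ((Module.finrank ℝ V : ℝ) / 2) * ∫ w, ‖𝓕 (G : V → ℂ) w‖ := by
  have hint := integrable_gaussian_modulated hb x
  have key := VectorFourier.integral_fourierIntegral_smul_eq_flip (L := innerₗ V)
    (e := Real.fourierChar) (μ := volume) (ν := volume) Real.continuous_fourierChar
    continuous_inner hint (𝓕⁻ G : 𝓢(V, ℂ)).integrable
  have hG : ∀ v, VectorFourier.fourierIntegral Real.fourierChar volume (innerₗ V).flip
      (𝓕⁻ G : 𝓢(V, ℂ)) v = G v := by
    intro v
    rw [flip_innerₗ]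
    change (𝓕 (𝓕⁻ G : 𝓢(V, ℂ)) : 𝓢(V, ℂ)) v = G v
    simp
  simp only [hG, smul_eq_mul] at key
  rw [← key]
  have hinv : ∫ w, ‖(𝓕⁻ G : 𝓢(V, ℂ)) w‖ = ∫ w, ‖𝓕 (G : V → ℂ) w‖ := by
    rw [← integral_neg_eq_self]
    congr 1; ext w
    rw [SchwartzMap.fourierInv_coe, Real.fourierInv_eq_fourier_neg, neg_neg]
  rw [← hinv, ← integral_const_mul]
  refine norm_integral_le_of_norm_le ((𝓕⁻ G : 𝓢(V, ℂ)).integrable.norm.const_mul _) (.of_forall fun w ↦ ?_)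
  rw [norm_mul]
  gcongr
  exact norm_fourier_gaussian_modulated_le hb x w

/-- Dispersive estimate for the free Schrödinger propagator. -/
theorem norm_integral_oscillatory_mul_le {r : ℝ} (hr : 0 < r) (x : V) (G : 𝓢(V, ℂ)) :
    ‖∫ v, Complex.exp (-(r * Complex.I) * ‖v‖ ^ 2 +
        2 * Real.pi * Complex.I * (⟪x, v⟫ : ℝ)) * G v‖ ≤
      (Real.pi / r) ^ ((Module.finrank ℝ V : ℝ) / 2) * ∫ w, ‖𝓕 (G : V → ℂ) w‖ := by
  have hlim : Tendsto (fun ε : ℝ ↦ ∫ v, Complex.exp (-(ε + r * Complex.I) * ‖v‖ ^ 2 +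
        2 * Real.pi * Complex.I * (⟪x, v⟫ : ℝ)) * G v) (𝓝[>] 0)
      (𝓝 (∫ v, Complex.exp (-(r * Complex.I) * ‖v‖ ^ 2 +
        2 * Real.pi * Complex.I * (⟪x, v⟫ : ℝ)) * G v)) := by
    refine tendsto_integral_filter_of_dominated_convergence (fun v ↦ ‖G v‖) ?_ ?_
      G.integrable.norm ?_
    · exact .of_forall fun ε ↦ (by fun_prop : Continuous _).aestronglyMeasurable
    · filter_upwards [self_mem_nhdsWithin] with ε hε
      refine .of_forall fun v ↦ ?_
      rw [norm_mul, Complex.norm_exp]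
      refine mul_le_of_le_one_left (norm_nonneg _) (Real.exp_le_one_iff.2 ?_)
      have : (-(ε + r * Complex.I) * ‖v‖ ^ 2 +
        2 * Real.pi * Complex.I * (⟪x, v⟫ : ℝ)) = ((-(ε * ‖v‖ ^ 2) : ℝ) : ℂ) +
          ((-(r * ‖v‖ ^ 2) + 2 * Real.pi * ⟪x, v⟫ : ℝ) : ℂ) * Complex.I := by
        push_cast; ring
      rw [this, Complex.add_re, Complex.ofReal_re, Complex.re_ofReal_mul, Complex.I_re]
      have hε' : 0 < ε := hε
      have : 0 ≤ ε * ‖v‖ ^ 2 := by positivity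
      linarith
    · refine .of_forall fun v ↦ ?_
      have hc : Continuous fun ε : ℝ ↦ Complex.exp (-(ε + r * Complex.I) * ‖v‖ ^ 2 +
        2 * Real.pi * Complex.I * (⟪x, v⟫ : ℝ)) * G v := by fun_prop
      simpa using (hc.tendsto 0).mono_left nhdsWithin_le_nhds
  refine le_of_tendsto hlim.norm ?_
  filter_upwards [self_mem_nhdsWithin] with ε hε
  refine (norm_integral_gaussian_mul_le (b := ε + r * Complex.I) (by simpa using hε) x G).trans ?_
  have : r ≤ ‖(ε + r * Complex.I : ℂ)‖ := by
    simpa [abs_of_pos hr] using Complex.abs_im_le_norm (ε + r * Complex.I : ℂ)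
  gcongr

end Gaussian

section Components

variable {d : ℕ}

theorem gfun_apply (f : SchwartzMap (E d) ℂ) (η : E d) (i : Fin d) :
    gfun f η i = ‖f η‖ ^ 2 * η i := by
  simp [gfun]

/-- The squared modulus of a Schwartz function, as a Schwartz function. -/
def schwartzNormSq (f : SchwartzMap (E d) ℂ) : SchwartzMap (E d) ℂ :=
  SchwartzMap.pairing (ContinuousLinearMap.mul ℝ ℂ) f
    (SchwartzMap.postcompCLM (𝕜 := ℝ) (Complex.conjCLE : ℂ →L[ℝ] ℂ) f)

theorem schwartzNormSq_apply (f : SchwartzMap (E d) ℂ) (η : E d) :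
    schwartzNormSq f η = ((‖f η‖ ^ 2 : ℝ) : ℂ) := by
  simp [schwartzNormSq, Complex.mul_conj, Complex.normSq_eq_norm_sq]

/-- The components of `gfun f`, as Schwartz functions. -/
def gSchwartz (f : SchwartzMap (E d) ℂ) (i : Fin d) : SchwartzMap (E d) ℂ :=
  SchwartzMap.smulLeftCLM ℂ (fun η : E d ↦ ⟪EuclideanSpace.single i (1 : ℝ), η⟫)
    (schwartzNormSq f)

theorem gSchwartz_apply (f : SchwartzMap (E d) ℂ) (i : Fin d) (η : E d) :
    gSchwartz f i η = (gfun f η i : ℂ) := by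
  rw [gSchwartz, SchwartzMap.smulLeftCLM_apply_apply (by fun_prop),
    schwartzNormSq_apply, gfun_apply]
  simp [EuclideanSpace.inner_single_left, mul_comm]

theorem continuous_gfun (f : SchwartzMap (E d) ℂ) : Continuous (gfun f) := by
  unfold gfun
  fun_prop

theorem integrable_gfun (f : SchwartzMap (E d) ℂ) : Integrable (gfun f) := by
  refine ((schwartzNormSq f).integrable_pow_mul volume 1).mono'
    (continuous_gfun f).aestronglyMeasurable (.of_forall fun η ↦ ?_)
  rw [schwartzNormSq_apply, gfun, norm_smul, Complex.norm_real, pow_one, mul_comm]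

theorem ftGi_eq (f : SchwartzMap (E d) ℂ) (i : Fin d) (x : E d) :
    ftGi f i x = ((2 * Real.pi) ^ (-(d : ℝ) / 2) : ℝ) *
      𝓕 (gSchwartz f i : E d → ℂ) ((2 * Real.pi)⁻¹ • x) := by
  rw [ftGi, Real.fourier_eq']
  congr 2
  ext η
  rw [gSchwartz_apply, smul_eq_mul, inner_smul_right, real_inner_comm]
  congr 2
  push_cast
  have : (Real.pi : ℂ) ≠ 0 := by exact_mod_cast Real.pi_ne_zero
  field_simp

theorem integral_sqrt_sum_norm_fourier_sq (f : SchwartzMap (E d) ℂ) :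
    ∫ w, √(∑ i, ‖𝓕 (gSchwartz f i : E d → ℂ) w‖ ^ 2) =
      (2 * Real.pi) ^ (-(d : ℝ) / 2) * L1ftg f := by
  have hpi : 0 < 2 * Real.pi := by positivity
  set c : ℝ := (2 * Real.pi) ^ (-(d : ℝ) / 2) with hc
  have hc0 : 0 ≤ c := by positivity
  set H : E d → ℝ := fun w ↦ √(∑ i, ‖𝓕 (gSchwartz f i : E d → ℂ) w‖ ^ 2) with hH
  have h1 : ∀ x : E d, √(∑ i, ‖ftGi f i x‖ ^ 2) = c * H ((2 * Real.pi)⁻¹ • x) := by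
    intro x
    simp only [hH, ftGi_eq, norm_mul, Complex.norm_real, mul_pow, ← Finset.mul_sum, ← hc]
    rw [Real.sqrt_mul (by positivity), Real.sqrt_sq (norm_nonneg _), Real.norm_of_nonneg hc0]
  rw [L1ftg]
  simp only [h1]
  rw [integral_const_mul, Measure.integral_comp_inv_smul_of_nonneg _ _ hpi.le,
    finrank_euclideanSpace_fin, smul_eq_mul, ← mul_assoc, ← mul_assoc]
  have : c * c * (2 * Real.pi) ^ d = 1 := by
    rw [hc, ← Real.rpow_natCast, ← Real.rpow_add hpi, ← Real.rpow_add hpi]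
    ring_nf
    simp
  rw [this, one_mul]

theorem L1g_nonneg (f : SchwartzMap (E d) ℂ) : 0 ≤ L1g f :=
  integral_nonneg fun _ ↦ norm_nonneg _

theorem L1ftg_nonneg (f : SchwartzMap (E d) ℂ) : 0 ≤ L1ftg f :=
  integral_nonneg fun _ ↦ Real.sqrt_nonneg _

theorem integrable_sqrt_sum_norm_fourier_sq (f : SchwartzMap (E d) ℂ) :
    Integrable fun w ↦ √(∑ i, ‖𝓕 (gSchwartz f i : E d → ℂ) w‖ ^ 2) := by
  have hF : ∀ i, (𝓕 (gSchwartz f i : E d → ℂ)) = (𝓕 (gSchwartz f i) : 𝓢(E d, ℂ)) :=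
    fun i ↦ (SchwartzMap.fourier_coe _).symm
  simp only [hF]
  refine (integrable_finsetSum Finset.univ
    fun i _ ↦ (𝓕 (gSchwartz f i) : 𝓢(E d, ℂ)).integrable.norm).mono' ?_ (.of_forall fun w ↦ ?_)
  · exact (by fun_prop : Continuous _).aestronglyMeasurable
  · rw [Real.norm_of_nonneg (Real.sqrt_nonneg _)]
    refine Real.sqrt_le_iff.2 ⟨by positivity, ?_⟩
    exact Finset.sum_sq_le_sq_sum_of_nonneg fun i _ ↦ norm_nonneg _

/-- The function `⟪gfun f, v⟫`, as a Schwartz function. -/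
def gSchwartzInner (f : SchwartzMap (E d) ℂ) (v : E d) : SchwartzMap (E d) ℂ :=
  ∑ i, (v i : ℂ) • gSchwartz f i

theorem gSchwartzInner_apply (f : SchwartzMap (E d) ℂ) (v η : E d) :
    gSchwartzInner f v η = (⟪gfun f η, v⟫ : ℂ) := by
  simp [gSchwartzInner, gSchwartz_apply, PiLp.inner_apply]

theorem norm_fourier_gSchwartzInner_le (f : SchwartzMap (E d) ℂ) (v w : E d) :
    ‖𝓕 (gSchwartzInner f v : E d → ℂ) w‖ ≤
      ‖v‖ * √(∑ i, ‖𝓕 (gSchwartz f i : E d → ℂ) w‖ ^ 2) := by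
  have h : 𝓕 (gSchwartzInner f v : E d → ℂ) w =
      ∑ i, (v i : ℂ) * 𝓕 (gSchwartz f i : E d → ℂ) w := by
    rw [← SchwartzMap.fourier_coe, ← SchwartzMap.fourierTransformCLM_apply (𝕜 := ℂ),
      gSchwartzInner, map_sum]
    simp [SchwartzMap.fourier_coe]
  rw [h, EuclideanSpace.norm_eq]
  refine (norm_sum_le _ _).trans ?_
  simp only [norm_mul, Complex.norm_real]
  exact Real.sum_mul_le_sqrt_mul_sqrt _ _ _

theorem integral_norm_fourier_gSchwartzInner_le (f : SchwartzMap (E d) ℂ) (v : E d) :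
    ∫ w, ‖𝓕 (gSchwartzInner f v : E d → ℂ) w‖ ≤
      ‖v‖ * ((2 * Real.pi) ^ (-(d : ℝ) / 2) * L1ftg f) := by
  rw [← integral_sqrt_sum_norm_fourier_sq, ← integral_const_mul]
  exact integral_mono_of_nonneg (.of_forall fun _ ↦ norm_nonneg _)
    ((integrable_sqrt_sum_norm_fourier_sq f).const_mul _)
    (.of_forall fun w ↦ norm_fourier_gSchwartzInner_le f v w)

theorem norm_integral_cos_mul_inner_gfun_le (f : SchwartzMap (E d) ℂ) (v a : E d) (r : ℝ) :
    ‖∫ η, Real.cos (r * (‖η‖ ^ 2 - 2 * ⟪η, a⟫)) * ⟪gfun f η, v⟫‖ ≤ ‖v‖ * L1g f := by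
  rw [L1g, ← integral_const_mul]
  refine norm_integral_le_of_norm_le ((integrable_gfun f).norm.const_mul _) (.of_forall fun η ↦ ?_)
  rw [norm_mul, mul_comm ‖v‖]
  exact (mul_le_of_le_one_left (norm_nonneg _) (Real.abs_cos_le_one _)).trans
    (norm_inner_le_norm _ _)

theorem norm_integral_cos_mul_inner_gfun_le_rpow (f : SchwartzMap (E d) ℂ) (v a : E d) {r : ℝ}
    (hr : 0 < r) :
    ‖∫ η, Real.cos (r * (‖η‖ ^ 2 - 2 * ⟪η, a⟫)) * ⟪gfun f η, v⟫‖ ≤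
      ‖v‖ * L1ftg f * (2 : ℝ) ^ (-(d : ℝ) / 2) * r ^ (-(d : ℝ) / 2) := by
  have hpi := Real.pi_pos
  have hre : ∀ η, Real.cos (r * (‖η‖ ^ 2 - 2 * ⟪η, a⟫)) * ⟪gfun f η, v⟫ =
      RCLike.re (Complex.exp (-(r * Complex.I) * ‖η‖ ^ 2 +
        2 * Real.pi * Complex.I * (⟪(r / Real.pi) • a, η⟫ : ℝ)) * gSchwartzInner f v η) := by
    intro η
    have : (-(r * Complex.I) * ‖η‖ ^ 2 +
        2 * Real.pi * Complex.I * (⟪(r / Real.pi) • a, η⟫ : ℝ)) =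
        ((-(r * (‖η‖ ^ 2 - 2 * ⟪η, a⟫)) : ℝ) : ℂ) * Complex.I := by
      rw [inner_smul_left, real_inner_comm]
      push_cast
      have : (Real.pi : ℂ) ≠ 0 := by exact_mod_cast Real.pi_ne_zero
      simp
      field_simp
      ring
    rw [this, gSchwartzInner_apply]
    simp only [RCLike.re_eq_complex_re]
    rw [mul_comm (Complex.exp _), Complex.re_ofReal_mul, Complex.exp_ofReal_mul_I_re, Real.cos_neg,
      mul_comm]
  have hint : Integrable fun η ↦ (Complex.exp (-(r * Complex.I) * ‖η‖ ^ 2 +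
        2 * Real.pi * Complex.I * (⟪(r / Real.pi) • a, η⟫ : ℝ)) * gSchwartzInner f v η) := by
    refine (gSchwartzInner f v).integrable.norm.mono'
      (by fun_prop : Continuous _).aestronglyMeasurable (.of_forall fun η ↦ ?_)
    rw [norm_mul, Complex.norm_exp]
    refine mul_le_of_le_one_left (norm_nonneg _) (Real.exp_le_one_iff.2 ?_)
    simp [← Complex.ofReal_pow]
  simp only [hre]
  rw [integral_re hint]
  refine (Complex.abs_re_le_norm _).trans ((norm_integral_oscillatory_mul_le hr _ _).trans ?_)
  rw [finrank_euclideanSpace_fin]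
  refine (mul_le_mul_of_nonneg_left (integral_norm_fourier_gSchwartzInner_le f v)
    (by positivity)).trans_eq ?_
  have hdiv : (Real.pi / r) ^ ((d : ℝ) / 2) =
      Real.pi ^ ((d : ℝ) / 2) * r ^ (-(d : ℝ) / 2) := by
    rw [Real.div_rpow hpi.le hr.le, neg_div, Real.rpow_neg hr.le, div_eq_mul_inv]
  have hone : Real.pi ^ ((d : ℝ) / 2) * Real.pi ^ (-(d : ℝ) / 2) = 1 := by
    rw [← Real.rpow_add hpi]
    ring_nf
    simp
  rw [hdiv, Real.mul_rpow two_pos.le hpi.le]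
  linear_combination (‖v‖ * L1ftg f * (2 : ℝ) ^ (-(d : ℝ) / 2) * r ^ (-(d : ℝ) / 2)) * hone

end Components

/-- A function bounded by `A` near zero and by `B r ^ (-s)`, `s > 1`, away from zero has bounded
primitive. -/
theorem norm_intervalIntegral_le_of_le_const_of_le_rpow {J : ℝ → ℝ} {A B s T : ℝ} (hs : 1 < s)
    (hT : 0 ≤ T) (hA : 0 ≤ A) (hB : 0 ≤ B) (hJ : IntervalIntegrable J volume 0 T)
    (h1 : ∀ r, ‖J r‖ ≤ A) (h2 : ∀ r, 0 < r → ‖J r‖ ≤ B * r ^ (-s)) :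
    ‖∫ r in (0 : ℝ)..T, J r‖ ≤ A + B / (s - 1) := by
  have hs' : 0 < s - 1 := by linarith
  have hB' : 0 ≤ B / (s - 1) := by positivity
  rcases le_total T 1 with hT1 | hT1
  · refine (intervalIntegral.norm_integral_le_of_norm_le_const fun r _ ↦ h1 r).trans ?_
    rw [sub_zero, abs_of_nonneg hT]
    nlinarith
  · have hJ1 : IntervalIntegrable J volume 0 1 :=
      hJ.mono_set (uIcc_subset_uIcc_left (by rw [uIcc_of_le hT]; exact ⟨zero_le_one, hT1⟩))
    have hJ2 : IntervalIntegrable J volume 1 T :=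
      hJ.mono_set (uIcc_subset_uIcc_right (by rw [uIcc_of_le hT]; exact ⟨zero_le_one, hT1⟩))
    rw [← intervalIntegral.integral_add_adjacent_intervals hJ1 hJ2]
    refine (norm_add_le _ _).trans (add_le_add ?_ ?_)
    · simpa using intervalIntegral.norm_integral_le_of_norm_le_const
        (a := 0) (b := 1) fun r _ ↦ h1 r
    · have h0 : (0 : ℝ) ∉ uIcc 1 T := by
        rw [uIcc_of_le hT1]; exact fun h ↦ absurd h.1 (by norm_num)
      have hi : IntervalIntegrable (fun r : ℝ ↦ r ^ (-s)) volume 1 T :=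
        intervalIntegral.intervalIntegrable_rpow (Or.inr h0)
      refine (intervalIntegral.norm_integral_le_of_norm_le hT1
        (ae_of_all _ fun r hr ↦ h2 r (zero_lt_one.trans hr.1)) (hi.const_mul B)).trans ?_
      rw [intervalIntegral.integral_const_mul, integral_rpow (Or.inr ⟨by linarith, h0⟩),
        div_eq_mul_inv B]
      refine mul_le_mul_of_nonneg_left ?_ hB
      rw [Real.one_rpow, ← neg_div_neg_eq, inv_eq_one_div, show -(-s + 1) = s - 1 by ring]
      gcongr
      have : 0 ≤ T ^ (-s + 1) := by positivity
      linarith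

theorem aestronglyMeasurable_intAvg {d : ℕ} {u : ℝ → E d}
    (hu : ContinuousOn u (Set.Ici (0 : ℝ))) {h t : ℝ} (hh : 0 < h) (ht : 0 ≤ t) :
    AEStronglyMeasurable (fun r ↦ intAvg u (t - h * r) t)
      (volume.restrict (Set.uIoc 0 (t / h))) := by
  rw [uIoc_of_le (by positivity)]
  refine ContinuousOn.aestronglyMeasurable ?_ measurableSet_Ioc
  have hmaps : MapsTo (fun r ↦ t - h * r) (Ioc 0 (t / h)) (uIcc 0 t) := by
    intro r hr
    rw [uIcc_of_le ht]
    have h1 : r * h ≤ t := (le_div_iff₀ hh).1 hr.2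
    have h2 : 0 < h * r := mul_pos hh hr.1
    exact ⟨by linarith, by linarith⟩
  have hint : IntegrableOn u (uIcc 0 t) := by
    rw [uIcc_of_le ht]
    exact (hu.mono Icc_subset_Ici_self).integrableOn_compact isCompact_Icc
  have hprim := (intervalIntegral.continuousOn_primitive_interval_left hint).comp
    (by fun_prop : Continuous fun r ↦ t - h * r).continuousOn hmaps
  have hlen : ContinuousOn (fun r ↦ (t - (t - h * r))⁻¹) (Ioc 0 (t / h)) := by
    refine ContinuousOn.inv₀ (by fun_prop) fun r hr ↦ ?_
    have : 0 < h * r := mul_pos hh hr.1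
    linarith
  exact hlen.smul hprim

theorem integrable_cos_mul_inner_gfun {d : ℕ} (f : SchwartzMap (E d) ℂ) (v : E d) {a : ℝ → E d}
    {T : ℝ} (ha : AEStronglyMeasurable a (volume.restrict (Set.uIoc 0 T))) :
    Integrable (fun p : ℝ × E d ↦
      Real.cos (p.1 * (‖p.2‖ ^ 2 - 2 * ⟪p.2, a p.1⟫)) * ⟪gfun f p.2, v⟫)
      ((volume.restrict (Set.uIoc 0 T)).prod volume) := by
  have : IsFiniteMeasure (volume.restrict (Set.uIoc 0 T)) :=
    inferInstanceAs (IsFiniteMeasure (volume.restrict (Ioc (min 0 T) (max 0 T))))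
  have hg := continuous_gfun f
  refine (((integrable_gfun f).norm.mul_const ‖v‖).comp_snd _).mono' ?_ (.of_forall fun p ↦ ?_)
  · have hcont : Continuous fun q : (ℝ × E d) × E d ↦
        Real.cos (q.1.1 * (‖q.1.2‖ ^ 2 - 2 * ⟪q.1.2, q.2⟫)) * ⟪gfun f q.1.2, v⟫ := by fun_prop
    have hpair : AEStronglyMeasurable (fun p : ℝ × E d ↦ (p, a p.1))
        ((volume.restrict (Set.uIoc 0 T)).prod volume) :=
      aestronglyMeasurable_id.prodMk ha.comp_fst
    have hcomp : ∀ Φ : (ℝ × E d) × E d → ℝ, Continuous Φ →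
        AEStronglyMeasurable (fun p : ℝ × E d ↦ Φ (p, a p.1))
          ((volume.restrict (Set.uIoc 0 T)).prod volume) :=
      fun Φ hΦ ↦ hΦ.comp_aestronglyMeasurable hpair
    exact hcomp _ hcont
  · rw [norm_mul]
    exact (mul_le_of_le_one_left (norm_nonneg _) (Real.abs_cos_le_one _)).trans
      (norm_inner_le_norm _ _)

/-- The time integral of the oscillatory integrals tested against a vector. -/
theorem norm_intervalIntegral_cos_mul_inner_gfun_le {d : ℕ} (hd : 3 ≤ d)
    (f : SchwartzMap (E d) ℂ) (v : E d) {a : ℝ → E d} {T : ℝ} (hT : 0 ≤ T)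
    (ha : AEStronglyMeasurable a (volume.restrict (Set.uIoc 0 T))) :
    ‖∫ r in (0 : ℝ)..T, ∫ η, Real.cos (r * (‖η‖ ^ 2 - 2 * ⟪η, a r⟫)) * ⟪gfun f η, v⟫‖ ≤
      ‖v‖ * (L1g f + ((d : ℝ) / 2 - 1) * Real.pi ^ ((d : ℝ) / 2) * L1ftg f) := by
  have hd' : (3 : ℝ) ≤ d := by exact_mod_cast hd
  have hL1 := L1g_nonneg f
  have hL2 := L1ftg_nonneg f
  have hJ : IntervalIntegrable (fun r ↦ ∫ η, Real.cos (r * (‖η‖ ^ 2 - 2 * ⟪η, a r⟫)) *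
      ⟪gfun f η, v⟫) volume 0 T := by
    rw [intervalIntegrable_iff]
    exact (integrable_cos_mul_inner_gfun f v ha).integral_prod_left
  refine (norm_intervalIntegral_le_of_le_const_of_le_rpow (s := (d : ℝ) / 2)
    (B := ‖v‖ * L1ftg f * (2 : ℝ) ^ (-((d : ℝ) / 2))) (by linarith) hT
    (by positivity) (by positivity) hJ
    (fun r ↦ norm_integral_cos_mul_inner_gfun_le f v (a r) r)
    (fun r hr ↦ (norm_integral_cos_mul_inner_gfun_le_rpow f v (a r) hr).trans_eq
      (by rw [neg_div]))).trans ?_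
  have hs : 0 < (d : ℝ) / 2 - 1 := by linarith
  have hconst : (2 : ℝ) ^ (-((d : ℝ) / 2)) / ((d : ℝ) / 2 - 1) ≤
      ((d : ℝ) / 2 - 1) * Real.pi ^ ((d : ℝ) / 2) := by
    have hpi : (4 : ℝ) ≤ 2 ^ ((d : ℝ) / 2) * Real.pi ^ ((d : ℝ) / 2) := by
      rw [← Real.mul_rpow two_pos.le Real.pi_pos.le]
      have h4 : (4 : ℝ) ≤ 2 * Real.pi := by linarith [Real.pi_gt_three]
      calc (4 : ℝ) ≤ 2 * Real.pi := h4
        _ = (2 * Real.pi) ^ (1 : ℝ) := (Real.rpow_one _).symm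
        _ ≤ _ := Real.rpow_le_rpow_of_exponent_le (by linarith) (by linarith)
    have h2 : (0 : ℝ) < 2 ^ ((d : ℝ) / 2) := by positivity
    rw [div_le_iff₀ hs, Real.rpow_neg two_pos.le, inv_le_iff_one_le_mul₀ h2]
    have hsq : (1 : ℝ) / 4 ≤ ((d : ℝ) / 2 - 1) ^ 2 := by nlinarith
    nlinarith
  calc _ = ‖v‖ * L1g f + ‖v‖ * L1ftg f * ((2 : ℝ) ^ (-((d : ℝ) / 2)) / ((d : ℝ) / 2 - 1)) := by
        ring
    _ ≤ ‖v‖ * L1g f + ‖v‖ * L1ftg f * (((d : ℝ) / 2 - 1) * Real.pi ^ ((d : ℝ) / 2)) := by gcongr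
    _ = _ := by ring

/-- in dimension `d ≥ 3`, for every `h > 0`, every bounded continuous
`u : [0,∞) → ℝ^d` and every `t ≥ 0`,
`|𝓕^(h)(u)(t)| ≤ 2‖g‖_{L¹} + (d−2) π^{d/2} ‖ĝ‖_{L¹} = 2 C_g^1`. -/
theorem statement2 (d : ℕ) (hd : 3 ≤ d) (f : SchwartzMap (E d) ℂ) (h : ℝ) (hh : 0 < h)
    (u : ℝ → E d) (hu : ContinuousOn u (Set.Ici (0 : ℝ)))
    (hub : ∃ M : ℝ, ∀ t ∈ Set.Ici (0 : ℝ), ‖u t‖ ≤ M) :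
    ∀ t ∈ Set.Ici (0 : ℝ),
      ‖calF f h u t‖ ≤ 2 * L1g f + ((d : ℝ) - 2) * Real.pi ^ ((d : ℝ) / 2) * L1ftg f ∧
        2 * L1g f + ((d : ℝ) - 2) * Real.pi ^ ((d : ℝ) / 2) * L1ftg f = 2 * Cg1 f := by
  
  intro t ht
  have hT : 0 ≤ t / h := div_nonneg ht hh.le
  have hd' : (3 : ℝ) ≤ d := by exact_mod_cast hd
  have heq : 2 * L1g f + ((d : ℝ) - 2) * Real.pi ^ ((d : ℝ) / 2) * L1ftg f = 2 * Cg1 f := by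
    rw [Cg1]; ring
  refine ⟨?_, heq⟩
  rw [heq, calF, norm_smul, Real.norm_eq_abs, abs_neg, abs_two]
  refine mul_le_mul_of_nonneg_left ?_ two_pos.le
  set F : E d → E d := fun η ↦ (∫ r in (0 : ℝ)..(t / h),
    Real.cos (r * (‖η‖ ^ 2 - 2 * ⟪η, intAvg u (t - h * r) t⟫))) • gfun f η
  set W := ∫ η, F η with hW
  have hC : 0 ≤ Cg1 f := by
    have hL1 := L1g_nonneg f
    have hL2 := L1ftg_nonneg f
    have hs : 0 ≤ (d : ℝ) / 2 - 1 := by linarith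
    rw [Cg1]
    positivity
  by_cases hF : Integrable F
  swap
  · rw [hW, integral_undef hF, norm_zero]
    exact hC
  have ha := aestronglyMeasurable_intAvg hu hh ht
  have hWW : ‖W‖ * ‖W‖ ≤ ‖W‖ * Cg1 f := by
    calc ‖W‖ * ‖W‖ = ⟪W, W⟫ := (real_inner_self_eq_norm_mul_norm W).symm
      _ = ∫ η, ∫ r in (0 : ℝ)..(t / h),
          Real.cos (r * (‖η‖ ^ 2 - 2 * ⟪η, intAvg u (t - h * r) t⟫)) * ⟪gfun f η, W⟫ := by
        nth_rw 2 [hW]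
        rw [← integral_inner hF]
        congr 1; ext η
        rw [intervalIntegral.integral_mul_const, inner_smul_right, real_inner_comm]
      _ = ∫ r in (0 : ℝ)..(t / h), ∫ η,
          Real.cos (r * (‖η‖ ^ 2 - 2 * ⟪η, intAvg u (t - h * r) t⟫)) * ⟪gfun f η, W⟫ :=
        (intervalIntegral_integral_swap (integrable_cos_mul_inner_gfun f W ha)).symm
      _ ≤ ‖W‖ * Cg1 f := (le_abs_self _).trans
        (norm_intervalIntegral_cos_mul_inner_gfun_le hd f W hT ha)
  rcases (norm_nonneg W).eq_or_lt with h0 | h0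
  · rw [← h0]; exact hC
  · exact le_of_mul_le_mul_left hWW h0
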